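/- Let A be an atomic weakly associative relation algebra and let (U,T) be a labelling system for A. Then there is a labelling system (U',T') extending (U,T) such that there is no flaw (u,a,v,b,c) in (U',T') with u,v ∈ U. -/

import Mathlib

universe u v

/-- A weakly associative relation algebra: a Boolean algebra equipped with
relative multiplication `comp`, converse `conv`, and identity `one'`
satisfying the WA axioms. -/
structure WA (A : Type*) [BooleanAlgebra A] where
  comp : A → A → A
  conv : A → A
  one' : A
  wassoc : ∀ x : A, comp (comp (x ⊓ one') ⊤) ⊤ = comp (x ⊓ one') ⊤
  rdist : ∀ x y z : A, comp (x ⊔ y) z = comp x z ⊔ comp y z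
  comp_one' : ∀ x : A, comp x one' = x
  conv_conv : ∀ x : A, conv (conv x) = x
  conv_sup : ∀ x y : A, conv (x ⊔ y) = conv x ⊔ conv y
  conv_comp : ∀ x y : A, conv (comp x y) = comp (conv y) (conv x)
  tarski : ∀ x y : A, comp (conv x) (comp x y)ᶜ ≤ yᶜ

/-- A labelling system for a WA `W`: a set of labelled edges
`T ⊆ U × At(A) × U` satisfying conditions (i)--(v). -/
structure LabSys {A : Type*} [BooleanAlgebra A] (W : WA A) (U : Type*) where
  T : Set (U × A × U)
  mem_atom : ∀ ⦃u : U⦄ ⦃a : A⦄ ⦃v : U⦄, (u, a, v) ∈ T → IsAtom a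
  functional : ∀ ⦃u : U⦄ ⦃a b : A⦄ ⦃v : U⦄, (u, a, v) ∈ T → (u, b, v) ∈ T → a = b
  ident_exists : ∀ a : A, IsAtom a → a ≤ W.one' → ∃ u : U, (u, a, u) ∈ T
  ident_iff : ∀ u v : U, u = v ↔ ∃ a : A, IsAtom a ∧ a ≤ W.one' ∧ (u, a, v) ∈ T
  conv_mem : ∀ ⦃u : U⦄ ⦃a : A⦄ ⦃v : U⦄, (u, a, v) ∈ T → (v, W.conv a, u) ∈ T
  triangle : ∀ ⦃u : U⦄ ⦃a : A⦄ ⦃v : U⦄ ⦃b : A⦄ ⦃w : U⦄ ⦃c : A⦄,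
    (u, a, v) ∈ T → (v, b, w) ∈ T → (u, c, w) ∈ T → c ≤ W.comp a b

/-- `(u,a,v,b,c)` is a flaw in the labelling system `L`. -/
def Flaw {A : Type*} [BooleanAlgebra A] (W : WA A) {U : Type*} (L : LabSys W U)
    (u : U) (a : A) (v : U) (b c : A) : Prop :=
  IsAtom a ∧ IsAtom b ∧ IsAtom c ∧ (u, a, v) ∈ L.T ∧ a ≤ W.comp b c ∧
    ∀ w : U, (u, b, w) ∉ L.T ∨ (w, c, v) ∉ L.T

namespace WA

variable {A : Type*} [BooleanAlgebra A] (W : WA A)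

theorem conv_mono {x y : A} (h : x ≤ y) : W.conv x ≤ W.conv y := by
  rw [← sup_eq_right, ← W.conv_sup, sup_eq_right.2 h]

theorem comp_mono_left {x y : A} (h : x ≤ y) (z : A) : W.comp x z ≤ W.comp y z := by
  rw [← sup_eq_right, ← W.rdist, sup_eq_right.2 h]

theorem comp_mono_right (x : A) {y z : A} (h : y ≤ z) : W.comp x y ≤ W.comp x z := by
  have := W.conv_mono (W.comp_mono_left (W.conv_mono h) (W.conv x))
  simpa only [W.conv_comp, W.conv_conv] using this

theorem comp_mono {x x' y y' : A} (hx : x ≤ x') (hy : y ≤ y') : W.comp x y ≤ W.comp x' y' :=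
  (W.comp_mono_left hx y).trans (W.comp_mono_right _ hy)

/-- Converse as an order isomorphism. -/
def convIso : A ≃o A where
  toFun := W.conv
  invFun := W.conv
  left_inv := W.conv_conv
  right_inv := W.conv_conv
  map_rel_iff' := by
    intro x y
    refine ⟨fun h => ?_, fun h => W.conv_mono h⟩
    have := W.conv_mono h
    simpa only [Equiv.coe_fn_mk, W.conv_conv] using this

theorem isAtom_conv {x : A} (h : IsAtom x) : IsAtom (W.conv x) :=
  (W.convIso.isAtom_iff x).2 h

theorem conv_one' : W.conv W.one' = W.one' := by
  have h := W.conv_comp (W.conv W.one') W.one'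
  rw [W.comp_one', W.conv_conv, W.comp_one'] at h
  exact h.symm

theorem one'_comp (x : A) : W.comp W.one' x = x := by
  have h := W.conv_comp (W.conv x) W.one'
  rw [W.comp_one', W.conv_conv, W.conv_one'] at h
  exact h.symm

theorem disjoint_conv_comp {x y z : A} (h : Disjoint (W.comp x y) z) :
    Disjoint (W.comp (W.conv x) z) y :=
  le_compl_iff_disjoint_right.1 <|
    (W.comp_mono_right _ (le_compl_iff_disjoint_left.2 h)).trans (W.tarski x y)

variable {W}

/-- Peircean law on atoms, cycling the left factor. -/
theorem le_conv_comp {a b c : A} (hb : IsAtom b) (hc : IsAtom c) (h : c ≤ W.comp a b) :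
    b ≤ W.comp (W.conv a) c := by
  by_contra hn
  have hd := W.disjoint_conv_comp (hb.not_le_iff_disjoint.1 hn).symm
  rw [W.conv_conv] at hd
  exact hc.1 (disjoint_self.1 (hd.mono_left h))

theorem conv_le_comp {a b c : A} (h : c ≤ W.comp a b) :
    W.conv c ≤ W.comp (W.conv b) (W.conv a) := by
  rw [← W.conv_comp]
  exact W.conv_mono h

/-- Peircean law on atoms, cycling the right factor. -/
theorem le_comp_conv {a b c : A} (ha : IsAtom a) (hc : IsAtom c) (h : c ≤ W.comp a b) :
    a ≤ W.comp c (W.conv b) := by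
  have h' := le_conv_comp (W.isAtom_conv ha) (W.isAtom_conv hc) (conv_le_comp h)
  simpa only [W.conv_comp, W.conv_conv] using W.conv_mono h'

theorem eq_of_le_one'_of_le_comp_conv {x y z : A} (hx : IsAtom x) (hy : IsAtom y) (hz : IsAtom z)
    (hz' : z ≤ W.one') (h : z ≤ W.comp x (W.conv y)) : x = y := by
  have h' := le_comp_conv hx hz h
  rw [W.conv_conv] at h'
  have h'' := h'.trans (W.comp_mono_left hz' y)
  rw [W.one'_comp] at h''
  exact (hy.le_iff_eq hx.1).1 h''

theorem le_comp_top (x : A) : x ≤ W.comp x ⊤ := by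
  simpa only [W.comp_one'] using W.comp_mono_right x (le_top (a := W.one'))

theorem comp_le_of_le {e x : A} (he : e ≤ W.one') (h : x ≤ W.comp e ⊤) (y : A) :
    W.comp x y ≤ W.comp e ⊤ := by
  have hw := W.wassoc e
  rw [inf_eq_left.2 he] at hw
  exact (W.comp_mono h le_top).trans hw.le

theorem conv_eq_of_le_comp_top {d e : A} (hd : IsAtom d) (hd' : d ≤ W.one') (he : IsAtom e)
    (he' : e ≤ W.one') (h : d ≤ W.comp e ⊤) : W.conv e = d := by
  have hne : W.comp (W.conv e) d ≠ ⊥ := by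
    intro h0
    have hdis : Disjoint (W.comp (W.conv e) d) ⊤ := by rw [h0]; exact disjoint_bot_left
    have := W.disjoint_conv_comp hdis
    rw [W.conv_conv] at this
    exact hd.1 (disjoint_self.1 (this.mono_left h))
  have h₁ : W.comp (W.conv e) d ≤ W.conv e := by
    simpa only [W.comp_one'] using W.comp_mono_right (W.conv e) hd'
  have h₂ : W.comp (W.conv e) d ≤ d := by
    have := W.comp_mono_left (W.conv_mono he') d
    rwa [W.conv_one', W.one'_comp] at this
  exact (((W.isAtom_conv he).le_iff_eq hne).1 h₁).symm.trans ((hd.le_iff_eq hne).1 h₂)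

theorem conv_eq_self {e : A} (he : IsAtom e) (he' : e ≤ W.one') : W.conv e = e :=
  conv_eq_of_le_comp_top he he' he he' (le_comp_top e)

theorem eq_of_le_comp_top {d e : A} (hd : IsAtom d) (hd' : d ≤ W.one') (he : IsAtom e)
    (he' : e ≤ W.one') (h : d ≤ W.comp e ⊤) : d = e :=
  (conv_eq_of_le_comp_top hd hd' he he' h).symm.trans (conv_eq_self he he')

theorem exists_domain (hat : ∀ x : A, x ≠ ⊥ → ∃ a : A, IsAtom a ∧ a ≤ x) {x : A}
    (hx : IsAtom x) :
    ∃ e, IsAtom e ∧ e ≤ W.one' ∧ e ≤ W.comp x (W.conv x) ∧ x ≤ W.comp e x := by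
  have hne : W.comp x (W.conv x) ⊓ W.one' ≠ ⊥ := by
    intro h0
    have := W.disjoint_conv_comp (disjoint_iff.2 h0)
    rw [W.comp_one'] at this
    exact (W.isAtom_conv hx).1 (disjoint_self.1 this)
  obtain ⟨e, he, hle⟩ := hat _ hne
  obtain ⟨h₁, h₂⟩ := le_inf_iff.1 hle
  have h := le_comp_conv hx he h₁
  rw [W.conv_conv] at h
  exact ⟨e, he, h₂, h₁, h⟩

theorem le_comp_conv_self (hat : ∀ x : A, x ≠ ⊥ → ∃ a : A, IsAtom a ∧ a ≤ x) {e x : A}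
    (hx : IsAtom x) (he : IsAtom e) (he' : e ≤ W.one') (h : x ≤ W.comp e ⊤) :
    e ≤ W.comp x (W.conv x) := by
  obtain ⟨d, hd, hd', h₁, -⟩ := exists_domain (W := W) hat hx
  rwa [← eq_of_le_comp_top hd hd' he he' (h₁.trans (comp_le_of_le he' h _))]

end WA

namespace LabSys

variable {A : Type*} [BooleanAlgebra A] {W : WA A} {U : Type*} (L : LabSys W U)

theorem exists_loop (p : U) : ∃ z, IsAtom z ∧ z ≤ W.one' ∧ (p, z, p) ∈ L.T :=
  (L.ident_iff p p).1 rfl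

theorem le_one'_of_loop {p : U} {z : A} (h : (p, z, p) ∈ L.T) : z ≤ W.one' := by
  obtain ⟨y, -, hy, hT⟩ := L.exists_loop p
  rwa [L.functional h hT]

theorem loop_le_comp_conv (hat : ∀ x : A, x ≠ ⊥ → ∃ a : A, IsAtom a ∧ a ≤ x) {p q : U}
    {z a b c : A} (hz : (p, z, p) ∈ L.T) (ha : (p, a, q) ∈ L.T) (hb : IsAtom b)
    (h : a ≤ W.comp b c) : z ≤ W.comp b (W.conv b) := by
  have hz' := L.le_one'_of_loop hz
  refine WA.le_comp_conv_self hat hb (L.mem_atom hz) hz' ?_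
  exact (WA.le_comp_conv hb (L.mem_atom ha) h).trans
    (WA.comp_le_of_le hz' ((L.triangle hz ha ha).trans (W.comp_mono_right z le_top)) _)

end LabSys

section Repair

variable {A : Type*} [BooleanAlgebra A] {W : WA A} {U : Type*} {L : LabSys W U}

namespace Flaw

variable {u v : U} {a b c : A}

theorem not_left_le_one' (hat : ∀ x : A, x ≠ ⊥ → ∃ a : A, IsAtom a ∧ a ≤ x)
    (h : Flaw W L u a v b c) : ¬ b ≤ W.one' := by
  obtain ⟨ha, hb, hc, hT, hle, hw⟩ := h
  intro hb'
  obtain ⟨z, hz, hz', hzT⟩ := L.exists_loop u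
  have hzb : z = b := WA.eq_of_le_comp_top hz hz' hb hb'
    ((L.loop_le_comp_conv hat hzT hT hb hle).trans (W.comp_mono_right b le_top))
  have hac : a = c := (hc.le_iff_eq ha.1).1 <| by
    simpa only [W.one'_comp] using hle.trans (W.comp_mono_left hb' c)
  subst hzb hac
  exact (hw u).elim (fun h => h hzT) (fun h => h hT)

theorem symm (h : Flaw W L u a v b c) : Flaw W L v (W.conv a) u (W.conv c) (W.conv b) := by
  obtain ⟨ha, hb, hc, hT, hle, hw⟩ := h
  refine ⟨W.isAtom_conv ha, W.isAtom_conv hc, W.isAtom_conv hb, L.conv_mem hT,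
    WA.conv_le_comp hle, fun w => (hw w).symm.imp (fun h h' => h ?_) (fun h h' => h ?_)⟩
  · simpa only [W.conv_conv] using L.conv_mem h'
  · simpa only [W.conv_conv] using L.conv_mem h'

end Flaw

variable (L) in
/-- The type of all flaws of `L`. -/
structure FlawIdx where
  u : U
  a : A
  v : U
  b : A
  c : A
  flaw : Flaw W L u a v b c

namespace FlawIdx

/-- `f.Edge p x` says that `x` labels the edge from `p` to the point witnessing the flaw `f`. -/
def Edge (f : FlawIdx L) (p : U) (x : A) : Prop :=
  (p = f.u ∧ x = f.b) ∨ (p = f.v ∧ x = W.conv f.c)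

variable {f : FlawIdx L} {p q : U} {x y z : A}

theorem Edge.isAtom (h : f.Edge p x) : IsAtom x := by
  have hf := f.flaw
  obtain ⟨rfl, rfl⟩ | ⟨rfl, rfl⟩ := h
  exacts [hf.2.1, W.isAtom_conv hf.2.2.1]

theorem Edge.not_le_one' (hat : ∀ x : A, x ≠ ⊥ → ∃ a : A, IsAtom a ∧ a ≤ x)
    (h : f.Edge p x) : ¬ x ≤ W.one' := by
  have hf := f.flaw
  obtain ⟨rfl, rfl⟩ | ⟨rfl, rfl⟩ := h
  exacts [hf.not_left_le_one' hat, hf.symm.not_left_le_one' hat]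

theorem Edge.le_comp_conv (hat : ∀ x : A, x ≠ ⊥ → ∃ a : A, IsAtom a ∧ a ≤ x)
    (hx : f.Edge p x) (hy : f.Edge q y) (hz : (p, z, q) ∈ L.T) :
    z ≤ W.comp x (W.conv y) := by
  obtain ⟨-, hb, -, hT, hle, -⟩ := f.flaw
  obtain ⟨-, hb', -, hT', hle', -⟩ := f.flaw.symm
  obtain ⟨rfl, rfl⟩ | ⟨rfl, rfl⟩ := hx <;> obtain ⟨rfl, rfl⟩ | ⟨rfl, rfl⟩ := hy
  · exact L.loop_le_comp_conv hat hz hT hb hle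
  · rw [L.functional hz hT, W.conv_conv]
    exact hle
  · rw [L.functional hz hT']
    exact hle'
  · exact L.loop_le_comp_conv hat hz hT' hb' hle'

theorem Edge.functional (hat : ∀ x : A, x ≠ ⊥ → ∃ a : A, IsAtom a ∧ a ≤ x)
    (hx : f.Edge p x) (hy : f.Edge p y) : x = y := by
  obtain ⟨z, hz, hz', hT⟩ := L.exists_loop p
  exact WA.eq_of_le_one'_of_le_comp_conv hx.isAtom hy.isAtom hz hz'
    (hx.le_comp_conv hat hy hT)

theorem exists_loopLabel (hat : ∀ x : A, x ≠ ⊥ → ∃ a : A, IsAtom a ∧ a ≤ x)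
    (f : FlawIdx L) :
    ∃ e, IsAtom e ∧ e ≤ W.one' ∧ ∀ p x, f.Edge p x → e ≤ W.comp (W.conv x) x := by
  obtain ⟨ha, hb, hc, -, hle, -⟩ := f.flaw
  obtain ⟨e, he, he', h₁, h₂⟩ := WA.exists_domain (W := W) hat (W.isAtom_conv hb)
  refine ⟨e, he, he', ?_⟩
  rintro p x (⟨rfl, rfl⟩ | ⟨rfl, rfl⟩)
  · simpa only [W.conv_conv] using h₁
  · rw [W.conv_conv]
    exact WA.le_comp_conv_self hat hc he he' ((WA.le_conv_comp hc ha hle).trans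
      (WA.comp_le_of_le he' (h₂.trans (W.comp_mono_right e le_top)) f.a))

end FlawIdx

/-- The labelled edges of the extension of `L` by one new point for every flaw, where `e` gives
the labels of the loops at the new points. -/
def RepairEdge (e : FlawIdx L → A) : U ⊕ FlawIdx L → A → U ⊕ FlawIdx L → Prop
  | .inl p, x, .inl q => (p, x, q) ∈ L.T
  | .inl p, x, .inr f => f.Edge p x
  | .inr f, x, .inl p => f.Edge p (W.conv x)
  | .inr f, x, .inr g => f = g ∧ x = e f

variable (L) in
/-- The extension of `L` by one new point for every flaw. -/
def LabSys.repair (hat : ∀ x : A, x ≠ ⊥ → ∃ a : A, IsAtom a ∧ a ≤ x) (e : FlawIdx L → A)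
    (he : ∀ f, IsAtom (e f)) (he' : ∀ f, e f ≤ W.one')
    (hE : ∀ f p x, f.Edge p x → e f ≤ W.comp (W.conv x) x) :
    LabSys W (U ⊕ FlawIdx L) where
  T := {t | RepairEdge e t.1 t.2.1 t.2.2}
  mem_atom := by
    rintro (p | f) a (q | g) h
    · exact L.mem_atom h
    · exact FlawIdx.Edge.isAtom h
    · simpa only [W.conv_conv] using W.isAtom_conv (FlawIdx.Edge.isAtom h)
    · obtain ⟨rfl, rfl⟩ := h
      exact he _
  functional := by
    rintro (p | f) a b (q | g) h h'
    · exact L.functional h h'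
    · exact FlawIdx.Edge.functional hat h h'
    · exact W.convIso.injective (FlawIdx.Edge.functional hat h h')
    · exact h.2.trans h'.2.symm
  ident_exists a ha ha' := (L.ident_exists a ha ha').imp' Sum.inl fun _ h => h
  ident_iff := by
    rintro (p | f) (q | g)
    · exact Sum.inl_injective.eq_iff.trans (L.ident_iff p q)
    · refine ⟨fun h => absurd h Sum.inl_ne_inr, ?_⟩
      rintro ⟨a, -, ha, h⟩
      exact absurd ha (FlawIdx.Edge.not_le_one' hat h)
    · refine ⟨fun h => absurd h Sum.inr_ne_inl, ?_⟩
      rintro ⟨a, ha, ha', h⟩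
      refine absurd ?_ (FlawIdx.Edge.not_le_one' hat h)
      rwa [WA.conv_eq_self ha ha']
    · refine ⟨fun h => ⟨e f, he f, he' f, Sum.inr_injective h, rfl⟩, ?_⟩
      rintro ⟨a, -, -, h⟩
      exact congrArg Sum.inr h.1
  conv_mem := by
    rintro (p | f) a (q | g) h
    · exact L.conv_mem h
    · change FlawIdx.Edge g p (W.conv (W.conv a))
      rwa [W.conv_conv]
    · exact h
    · obtain ⟨rfl, rfl⟩ := h
      exact ⟨rfl, WA.conv_eq_self (he f) (he' f)⟩
  triangle := by
    rintro (p | f) a (q | g) b (r | k) c h₁ h₂ h₃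
    · exact L.triangle h₁ h₂ h₃
    · replace h₂ : k.Edge q b := h₂
      replace h₃ : k.Edge p c := h₃
      have h := WA.le_comp_conv h₃.isAtom (L.mem_atom h₁) (h₃.le_comp_conv hat h₂ h₁)
      rwa [W.conv_conv] at h
    · simpa only [W.conv_conv] using FlawIdx.Edge.le_comp_conv hat h₁ h₂ h₃
    · obtain ⟨rfl, rfl⟩ := h₂
      replace h₁ : g.Edge p a := h₁
      replace h₃ : g.Edge p c := h₃
      obtain rfl := h₃.functional hat h₁
      simpa only [W.conv_conv] using WA.le_conv_comp h₁.isAtom (he g) (hE g p c h₁)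
    · replace h₁ : f.Edge q (W.conv a) := h₁
      replace h₃ : f.Edge r (W.conv c) := h₃
      have hc := W.isAtom_conv h₃.isAtom
      have h := h₁.le_comp_conv hat h₃ h₂
      rw [W.conv_conv] at hc h
      simpa only [W.conv_conv] using WA.le_conv_comp hc (L.mem_atom h₂) h
    · obtain ⟨rfl, rfl⟩ := h₃
      replace h₁ : f.Edge q (W.conv a) := h₁
      replace h₂ : f.Edge q b := h₂
      have h := hE f q b h₂
      rwa [← h₁.functional hat h₂, W.conv_conv, h₁.functional hat h₂] at h
    · obtain ⟨rfl, rfl⟩ := h₁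
      replace h₂ : f.Edge r (W.conv b) := h₂
      replace h₃ : f.Edge r (W.conv c) := h₃
      have hc := W.isAtom_conv h₃.isAtom
      have h := hE f r _ h₃
      rw [W.conv_conv] at h hc
      obtain rfl := W.convIso.injective (h₂.functional hat h₃)
      simpa only [W.conv_conv] using WA.le_comp_conv hc (he f) h
    · obtain ⟨rfl, rfl⟩ := h₁
      obtain ⟨rfl, rfl⟩ := h₂
      obtain ⟨-, rfl⟩ := h₃
      simpa only [WA.conv_eq_self (he f) (he' f)] using
        WA.le_comp_conv_self hat (he f) (he f) (he' f) (WA.le_comp_top _)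

end Repair

/-- Lemma B: every labelling system has an extension with no flaw whose
endpoints both come from the original system. -/
theorem stmt_4 {A : Type u} [BooleanAlgebra A] (W : WA A)
    (hatomic : ∀ x : A, x ≠ ⊥ → ∃ a : A, IsAtom a ∧ a ≤ x)
    {U : Type v} (L : LabSys W U) :
    ∃ (U' : Type (max u v)) (i : U ↪ U') (L' : LabSys W U'),
      (∀ (p : U) (x : A) (q : U), (p, x, q) ∈ L.T → (i p, x, i q) ∈ L'.T) ∧
      ∀ (u v : U) (a b c : A), ¬ Flaw W L' (i u) a (i v) b c := by
  choose e he he' hE using FlawIdx.exists_loopLabel (L := L) hatomic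
  refine ⟨U ⊕ FlawIdx L, ⟨Sum.inl, Sum.inl_injective⟩, L.repair hatomic e he he' hE,
    fun p x q h => h, ?_⟩
  rintro p q a b c ⟨ha, hb, hc, hT, hle, hw⟩
  let f : FlawIdx L := ⟨p, a, q, b, c, ha, hb, hc, hT, hle, fun w => hw (.inl w)⟩
  exact (hw (.inr f)).elim (fun h => h (Or.inl ⟨rfl, rfl⟩)) (fun h => h (Or.inr ⟨rfl, rfl⟩))
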